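/- arXiv:2509.09240 — 3 statements merged into one kernel-verified Lean document; each statement's English description precedes it below -/
import Mathlib

section
/- Let n ≥ 1 and let f : 𝕋 → M_n(ℂ) be such that f(z) is a Hermitian matrix for every z ∈ 𝕋, and let (f₋, f₊) be a right canonical factorization datum for f. Then the interior extension takes Hermitian values: f₋(z̄) · f₊(z) is a Hermitian matrix for every z in the closed unit disk 𝔻̄. -/
open Complex Matrix

/-- The closed unit disk in `ℂ`. -/
def closedDisk : Set ℂ := {z : ℂ | ‖z‖ ≤ 1}

/-- The open unit disk in `ℂ`. -/
def openDisk : Set ℂ := {z : ℂ | ‖z‖ < 1}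

/-- A right canonical factorization datum for `f : 𝕋 → Mₙ(ℂ)`: a pair `(fm, fp)` of maps on the
closed unit disk, continuous there, holomorphic on the open disk, taking invertible values, with
`f z = fm z̄ * fp z` on the unit circle. -/
structure RightCanonicalFactorizationDatum (n : ℕ)
    (f fm fp : ℂ → Matrix (Fin n) (Fin n) ℂ) : Prop where
  cont_m : ContinuousOn fm closedDisk
  cont_p : ContinuousOn fp closedDisk
  hol_m : ∀ i j, DifferentiableOn ℂ (fun z => fm z i j) openDisk
  hol_p : ∀ i j, DifferentiableOn ℂ (fun z => fp z i j) openDisk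
  unit_m : ∀ z ∈ closedDisk, IsUnit (fm z)
  unit_p : ∀ z ∈ closedDisk, IsUnit (fp z)
  factor : ∀ z : ℂ, ‖z‖ = 1 → f z = fm (starRingEnd ℂ z) * fp z


/-- A function continuous on the closed unit disk, holomorphic inside, and real on the unit circle
is real on the closed disk. -/
theorem im_eq_zero_of_im_eq_zero_on_circle {h : ℂ → ℂ}
    (hc : ContinuousOn h closedDisk) (hd : DifferentiableOn ℂ h openDisk)
    (hr : ∀ z : ℂ, ‖z‖ = 1 → (h z).im = 0) {z : ℂ} (hz : z ∈ closedDisk) : (h z).im = 0 := by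
  have hball : openDisk = Metric.ball (0 : ℂ) 1 := by ext; simp [openDisk]
  have hcl : closedDisk = closure (Metric.ball (0 : ℂ) 1) := by
    rw [closure_ball _ one_ne_zero]; ext; simp [closedDisk]
  have key : ∀ c : ℂ, c.re = 0 → (c * h z).re ≤ 0 := by
    intro c hc0
    have hdc : DiffContOnCl ℂ (fun w => Complex.exp (c * h w)) (Metric.ball 0 1) := by
      constructor
      · rw [← hball]; exact (hd.const_mul c).cexp
      · rw [← hcl]; exact (continuousOn_const.mul hc).cexp
    have hle := Complex.norm_le_of_forall_mem_frontier_norm_le (C := 1) Metric.isBounded_ball hdc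
      (fun w hw => by
        rw [frontier_ball _ one_ne_zero, mem_sphere_zero_iff_norm] at hw
        simp [Complex.norm_exp, hr w hw, hc0]) (hcl ▸ hz)
    simpa [Complex.norm_exp] using hle
  have h₁ := key Complex.I (by simp)
  have h₂ := key (-Complex.I) (by simp)
  simp at h₁ h₂
  linarith

/-- A matrix function continuous on the closed unit disk, holomorphic inside, and Hermitian on the
unit circle is Hermitian on the closed disk. -/
theorem isHermitian_of_isHermitian_on_circle {ι : Type*} {H : ℂ → Matrix ι ι ℂ}
    (hc : ContinuousOn H closedDisk)
    (hd : ∀ i j, DifferentiableOn ℂ (fun z => H z i j) openDisk)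
    (hr : ∀ z : ℂ, ‖z‖ = 1 → (H z).IsHermitian) {z : ℂ} (hz : z ∈ closedDisk) :
    (H z).IsHermitian := by
  have hc' : ∀ i j, ContinuousOn (fun z => H z i j) closedDisk := fun i j =>
    (continuous_id.matrix_elem i j).comp_continuousOn hc
  ext i j
  have hsum := im_eq_zero_of_im_eq_zero_on_circle (h := fun z => H z i j + H z j i)
    ((hc' i j).add (hc' j i)) ((hd i j).add (hd j i))
    (fun w hw => by simp [← (hr w hw).apply i j]) hz
  have hdiff := im_eq_zero_of_im_eq_zero_on_circle
    (h := fun z => Complex.I * (H z i j - H z j i))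
    (continuousOn_const.mul ((hc' i j).sub (hc' j i))) (((hd i j).sub (hd j i)).const_mul _)
    (fun w hw => by simp [← (hr w hw).apply i j]) hz
  simp at hsum hdiff
  apply Complex.ext
  · simp; linarith
  · simp; linarith

theorem DifferentiableOn.matrix_det_of_entries {ι : Type*} [Fintype ι] [DecidableEq ι]
    {M : ℂ → Matrix ι ι ℂ} {s : Set ℂ} (hM : ∀ i j, DifferentiableOn ℂ (fun z => M z i j) s) :
    DifferentiableOn ℂ (fun z => (M z).det) s := by
  simp only [Matrix.det_apply']
  exact DifferentiableOn.fun_sum fun σ _ =>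
    (DifferentiableOn.fun_finsetProd fun i _ => hM (σ i) i).const_mul _

theorem DifferentiableOn.matrix_adjugate_of_entries {ι : Type*} [Fintype ι] [DecidableEq ι]
    {M : ℂ → Matrix ι ι ℂ} {s : Set ℂ} (hM : ∀ i j, DifferentiableOn ℂ (fun z => M z i j) s)
    (i j : ι) : DifferentiableOn ℂ (fun z => (M z).adjugate i j) s := by
  simp only [Matrix.adjugate_apply]
  refine DifferentiableOn.matrix_det_of_entries fun k l => ?_
  by_cases hk : k = j
  · subst hk; simp
  · simpa [Matrix.updateRow_ne hk] using hM k l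

theorem DifferentiableOn.matrix_inv_of_entries {ι : Type*} [Fintype ι] [DecidableEq ι]
    {M : ℂ → Matrix ι ι ℂ} {s : Set ℂ} (hM : ∀ i j, DifferentiableOn ℂ (fun z => M z i j) s)
    (hu : ∀ z ∈ s, IsUnit (M z)) (i j : ι) :
    DifferentiableOn ℂ (fun z => (M z)⁻¹ i j) s := by
  simp only [Matrix.inv_def, Ring.inverse_eq_inv', Matrix.smul_apply, smul_eq_mul]
  exact ((DifferentiableOn.matrix_det_of_entries hM).fun_inv fun z hz =>
    ((Matrix.isUnit_iff_isUnit_det _).1 (hu z hz)).ne_zero).mul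
    (DifferentiableOn.matrix_adjugate_of_entries hM i j)

theorem ContinuousOn.matrix_inv_of_isUnit {ι X : Type*} [Fintype ι] [DecidableEq ι]
    [TopologicalSpace X] {M : X → Matrix ι ι ℂ} {s : Set X} (hM : ContinuousOn M s)
    (hu : ∀ z ∈ s, IsUnit (M z)) : ContinuousOn (fun z => (M z)⁻¹) s := by
  simp only [Matrix.inv_def, Ring.inverse_eq_inv']
  exact (((continuous_id.matrix_det).comp_continuousOn hM).inv₀ fun z hz =>
    ((Matrix.isUnit_iff_isUnit_det _).1 (hu z hz)).ne_zero).smul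
    ((continuous_id.matrix_adjugate).comp_continuousOn hM)

/-- If the symbol `f` takes Hermitian values on the unit circle, then its interior extension
`f^e(z) = f₋(z̄) f₊(z)` takes Hermitian values on the whole closed unit disk. -/
theorem interior_extension_hermitian
    {n : ℕ} (hn : 1 ≤ n) (f fm fp : ℂ → Matrix (Fin n) (Fin n) ℂ)
    (hherm : ∀ z : ℂ, ‖z‖ = 1 → (f z).IsHermitian)
    (hf : RightCanonicalFactorizationDatum n f fm fp) :
    ∀ z ∈ closedDisk, (fm (starRingEnd ℂ z) * fp z).IsHermitian := by
  set G : ℂ → Matrix (Fin n) (Fin n) ℂ := fun z => (fm (starRingEnd ℂ z))ᴴ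
  have hmap : Set.MapsTo (starRingEnd ℂ) closedDisk closedDisk := fun z hz => by
    simpa [closedDisk] using hz
  have hopen : IsOpen openDisk := isOpen_lt continuous_norm continuous_const
  have hsub : openDisk ⊆ closedDisk := fun z (hz : ‖z‖ < 1) => hz.le
  have hmu : ∀ z ∈ closedDisk, IsUnit (fm (starRingEnd ℂ z)) := fun z hz =>
    hf.unit_m _ (hmap hz)
  have hGu : ∀ z ∈ closedDisk, IsUnit (G z) := fun z hz => (hmu z hz).star
  have hGc : ContinuousOn G closedDisk :=
    (continuous_id.matrix_conjTranspose).comp_continuousOn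
      (hf.cont_m.comp Complex.continuous_conj.continuousOn hmap)
  have hGd : ∀ i j, DifferentiableOn ℂ (fun z => G z i j) openDisk := fun i j z hz => by
    have hz' : starRingEnd ℂ z ∈ openDisk := by simpa [openDisk] using hz
    have := ((hf.hol_m j i).differentiableAt (hopen.mem_nhds hz')).conj_conj
    rw [Complex.conj_conj] at this
    exact this.differentiableWithinAt
  have hH : ∀ z ∈ closedDisk, (fp z * (G z)⁻¹).IsHermitian := fun z hz => by
    refine isHermitian_of_isHermitian_on_circle (H := fun z => fp z * (G z)⁻¹)
      ?_ (fun i j => ?_) (fun w hw => ?_) hz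
    · exact hf.cont_p.mul (hGc.matrix_inv_of_isUnit hGu)
    · simp only [Matrix.mul_apply]
      exact DifferentiableOn.fun_sum fun k _ => (hf.hol_p i k).mul
        (DifferentiableOn.matrix_inv_of_entries hGd (fun z hz => hGu z (hsub hz)) k j)
    · have hdet := (Matrix.isUnit_iff_isUnit_det _).1 (hmu w (le_of_eq hw))
      have := Matrix.isHermitian_mul_mul_conjTranspose (fm (starRingEnd ℂ w))⁻¹
        (hf.factor w hw ▸ hherm w hw)
      rwa [Matrix.nonsing_inv_mul_cancel_left _ _ hdet, Matrix.conjTranspose_nonsing_inv] at this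
  intro z hz
  have := Matrix.isHermitian_mul_mul_conjTranspose (fm (starRingEnd ℂ z)) (hH z hz)
  rwa [Matrix.mul_assoc, Matrix.nonsing_inv_mul_cancel_right _ _
    ((Matrix.isUnit_iff_isUnit_det _).1 (hGu z hz))] at this
end

section
/- Let h = [[0, −2, 0], [−2, 1, 1], [0, 1, −1]] (a real symmetric 3×3 matrix), let B = [[0, h], [h, 0]] ∈ M_6(ℂ) in 3×3 block form, and let I = [[0, 1₃], [1₃, 0]] where 1₃ is the 3×3 identity. Then B is Hermitian, its negative eigenvalues are exactly −1−√3, −2 and 1−√3, the sum of the eigenspaces of B for its negative eigenvalues is a 3-dimensional subspace of ℂ⁶, and the intersection of this subspace with the (−1)-eigenspace of I is 1-dimensional. (In the notation of the paper, n₋(−1,1) = 1 for the deformed Hamiltonian H₁.) -/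
open Complex Matrix

/-- The set of negative (real) eigenvalues of a `6×6` complex matrix. -/
def negEigenvalues (A : Matrix (Fin 3 ⊕ Fin 3) (Fin 3 ⊕ Fin 3) ℂ) : Set ℂ :=
  {μ : ℂ | μ ∈ spectrum ℂ A ∧ ∃ x : ℝ, (x : ℂ) = μ ∧ x < 0}

/-- The sum of the eigenspaces of `A` for its negative eigenvalues, as a subspace of `ℂ⁶`. -/
noncomputable def negSpace (A : Matrix (Fin 3 ⊕ Fin 3) (Fin 3 ⊕ Fin 3) ℂ) :
    Submodule ℂ ((Fin 3 ⊕ Fin 3) → ℂ) :=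
  ⨆ μ ∈ negEigenvalues A, Module.End.eigenspace (Matrix.toLin' A) μ

/-- The inversion symmetry operator `I = [[0, 1₃], [1₃, 0]]`. -/
noncomputable def inversionOp : Matrix (Fin 3 ⊕ Fin 3) (Fin 3 ⊕ Fin 3) ℂ :=
  Matrix.fromBlocks 0 1 1 0

/-- The off-diagonal block `h₁(−1,1)` of the deformed Hamiltonian at the fixed point `(−1,1)`. -/
noncomputable def hMinusOneOne : Matrix (Fin 3) (Fin 3) ℂ := !![0, -2, 0; -2, 1, 1; 0, 1, -1]

/-- The deformed Hamiltonian `H₁(−1,1)` in block form. -/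
noncomputable def BMinusOneOne : Matrix (Fin 3 ⊕ Fin 3) (Fin 3 ⊕ Fin 3) ℂ :=
  Matrix.fromBlocks 0 hMinusOneOne hMinusOneOne 0

/-- For a root `c` of `X³ - 6X - 4`, an eigenvector of `hMinusOneOne` with eigenvalue `c`. -/
noncomputable def hVec (c : ℂ) : Fin 3 → ℂ := ![1 - c ^ 2 / 2, c + 1, 1]

/-- The vector `(hVec c, s • hVec c)` of parity `s`. -/
noncomputable def parityVec (s c : ℂ) : Fin 3 ⊕ Fin 3 → ℂ := Sum.elim (hVec c) (s • hVec c)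

lemma BMinusOneOne_mulVec_eq_smul_iff (μ : ℂ) (v : Fin 3 ⊕ Fin 3 → ℂ) :
    BMinusOneOne *ᵥ v = μ • v ↔
      (-2 * v (.inr 1) = μ * v (.inl 0) ∧
        -2 * v (.inr 0) + v (.inr 1) + v (.inr 2) = μ * v (.inl 1) ∧
        v (.inr 1) - v (.inr 2) = μ * v (.inl 2)) ∧
      (-2 * v (.inl 1) = μ * v (.inr 0) ∧
        -2 * v (.inl 0) + v (.inl 1) + v (.inl 2) = μ * v (.inr 1) ∧
        v (.inl 1) - v (.inl 2) = μ * v (.inr 2)) := by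
  simp [funext_iff, BMinusOneOne, hMinusOneOne, Matrix.mulVec, dotProduct, Fin.forall_fin_succ,
    Fin.sum_univ_three, Matrix.fromBlocks, sub_eq_add_neg]

lemma parityVec_mem_eigenspace {s c : ℂ} (hs : s ^ 2 = 1) (hc : c ^ 3 - 6 * c - 4 = 0) :
    parityVec s c ∈ Module.End.eigenspace (Matrix.toLin' BMinusOneOne) (s * c) := by
  rw [Module.End.mem_eigenspace_iff, Matrix.toLin'_apply, BMinusOneOne_mulVec_eq_smul_iff]
  simp only [parityVec, hVec, Sum.elim_inl, Sum.elim_inr, Pi.smul_apply, smul_eq_mul,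
    Matrix.cons_val]
  refine ⟨⟨?_, ?_, ?_⟩, ?_, ?_, ?_⟩
  · linear_combination s / 2 * hc
  · ring
  · ring
  · linear_combination (1 / 2) * hc - c * (1 - c ^ 2 / 2) * hs
  · linear_combination -c * (c + 1) * hs
  · linear_combination -c * hs

lemma exists_eq_of_mem_eigenspace {μ : ℂ} {v : Fin 3 ⊕ Fin 3 → ℂ}
    (hv : v ∈ Module.End.eigenspace (Matrix.toLin' BMinusOneOne) μ) :
    ∃ a b : ℂ, v = a • parityVec 1 μ + b • parityVec (-1) (-μ) ∧
      (a = 0 ∨ μ ^ 3 - 6 * μ - 4 = 0) ∧ (b = 0 ∨ (-μ) ^ 3 - 6 * (-μ) - 4 = 0) := by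
  rw [Module.End.mem_eigenspace_iff, Matrix.toLin'_apply, BMinusOneOne_mulVec_eq_smul_iff] at hv
  obtain ⟨⟨h1, h2, h3⟩, h4, h5, h6⟩ := hv
  refine ⟨(v (.inl 2) + v (.inr 2)) / 2, (v (.inl 2) - v (.inr 2)) / 2, ?_, ?_, ?_⟩
  · ext i
    rcases i with i | i <;> fin_cases i <;> simp [parityVec, hVec]
    · linear_combination (-1 / 2) * h5 + (1 / 2) * h6 - μ / 2 * h3
    · linear_combination h6
    · ring
    · linear_combination (-1 / 2) * h2 + (1 / 2) * h3 - μ / 2 * h6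
    · linear_combination h3
    · ring
  · rw [← mul_eq_zero]
    linear_combination (h1 + h4) - μ / 2 * (h2 + h5) + (2 + μ / 2 - μ ^ 2 / 2) * (h3 + h6)
  · rw [← mul_eq_zero]
    linear_combination (h4 - h1) + μ / 2 * (h5 - h2) + (2 - μ / 2 - μ ^ 2 / 2) * (h6 - h3)

lemma sqrt_three_sq : (Real.sqrt 3 : ℂ) ^ 2 = 3 := by
  rw [← Complex.ofReal_pow, Real.sq_sqrt (by norm_num)]
  norm_num

lemma eq_neg_two_or_of_cubic {x : ℝ} (h : (x : ℂ) ^ 3 - 6 * x - 4 = 0) :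
    x = -2 ∨ x = 1 - √3 ∨ x = 1 + √3 := by
  have h' : x ^ 3 - 6 * x - 4 = 0 := by exact_mod_cast h
  have h3 : √3 ^ 2 = 3 := Real.sq_sqrt (by norm_num)
  have : (x + 2) * ((x - (1 - √3)) * (x - (1 + √3))) = 0 := by
    linear_combination h' - (x + 2) * h3
  rcases mul_eq_zero.1 this with h | h
  · exact .inl (by linarith)
  · rcases mul_eq_zero.1 h with h | h
    · exact .inr (.inl (by linarith))
    · exact .inr (.inr (by linarith))

lemma one_lt_sqrt_three : 1 < √3 := by
  rw [Real.lt_sqrt] <;> norm_num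

/-- Eigenvectors of `BMinusOneOne` for `-2`, `1 - √3` and `-1 - √3`. -/
noncomputable def negVec : Fin 3 → (Fin 3 ⊕ Fin 3 → ℂ) :=
  ![parityVec 1 (-2), parityVec 1 (1 - (Real.sqrt 3 : ℂ)), parityVec (-1) (1 + (Real.sqrt 3 : ℂ))]

lemma cubic_one_add_of_sq {r : ℂ} (hr : r ^ 2 = 3) : (1 + r) ^ 3 - 6 * (1 + r) - 4 = 0 := by
  linear_combination (r + 3) * hr

lemma negVec_mem_eigenspace (i : Fin 3) :
    negVec i ∈ Module.End.eigenspace (Matrix.toLin' BMinusOneOne)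
      (![-2, 1 - (Real.sqrt 3 : ℂ), -1 - (Real.sqrt 3 : ℂ)] i) := by
  fin_cases i
  · simpa [negVec] using parityVec_mem_eigenspace (s := 1) (c := -2) (by norm_num) (by norm_num)
  · simpa [negVec] using parityVec_mem_eigenspace (s := 1) (c := 1 - (Real.sqrt 3 : ℂ))
      (by norm_num) (by simpa [sub_eq_add_neg] using
        cubic_one_add_of_sq (r := -(Real.sqrt 3 : ℂ)) (by rw [neg_sq, sqrt_three_sq]))
  · have h := parityVec_mem_eigenspace (s := -1) (by norm_num) (cubic_one_add_of_sq sqrt_three_sq)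
    rw [show (-1 : ℂ) * (1 + (Real.sqrt 3 : ℂ)) = -1 - (Real.sqrt 3 : ℂ) by ring] at h
    simpa [negVec] using h

lemma negVec_ne_zero (i : Fin 3) : negVec i ≠ 0 := by
  intro h
  have := congrFun h (.inl 2)
  fin_cases i <;> simp [negVec, parityVec, hVec] at this

lemma mem_of_mem_eigenspace_of_neg {x : ℝ} (hx : x < 0) {v : Fin 3 ⊕ Fin 3 → ℂ}
    (hv : v ∈ Module.End.eigenspace (Matrix.toLin' BMinusOneOne) (x : ℂ)) :
    v ∈ Submodule.span ℂ (Set.range negVec) ∧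
      (v ≠ 0 → (x : ℂ) ∈ ({-1 - (Real.sqrt 3 : ℂ), -2, 1 - (Real.sqrt 3 : ℂ)} : Set ℂ)) := by
  obtain ⟨a, b, rfl, ha, hb⟩ := exists_eq_of_mem_eigenspace hv
  have hs := one_lt_sqrt_three
  have hA : a = 0 ∨ x = -2 ∨ x = 1 - √3 := by
    refine ha.imp_right fun h => ?_
    rcases eq_neg_two_or_of_cubic h with h | h | h
    · exact .inl h
    · exact .inr h
    · linarith
  have hB : b = 0 ∨ -x = 1 + √3 := by
    refine hb.imp_right fun h => ?_
    rcases eq_neg_two_or_of_cubic (x := -x) (by simpa using h) with h | h | h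
    · linarith
    · linarith
    · exact h
  have hmem (i : Fin 3) : negVec i ∈ Submodule.span ℂ (Set.range negVec) :=
    Submodule.subset_span ⟨i, rfl⟩
  constructor
  · refine add_mem ?_ ?_
    · rcases hA with rfl | rfl | rfl
      · simp
      · exact Submodule.smul_mem _ _ (by simpa [negVec] using hmem 0)
      · exact Submodule.smul_mem _ _ (by simpa [negVec] using hmem 1)
    · rcases hB with rfl | h
      · simp
      · refine Submodule.smul_mem _ _ ?_
        rw [← Complex.ofReal_neg, h]
        simpa [negVec] using hmem 2
  · intro hne
    rcases hA with rfl | rfl | rfl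
    · rcases hB with rfl | h
      · simp at hne
      · obtain rfl : x = -1 - √3 := by linarith
        simp
    · simp
    · simp

lemma negEigenvalues_BMinusOneOne :
    negEigenvalues BMinusOneOne = {-1 - (Real.sqrt 3 : ℂ), -2, 1 - (Real.sqrt 3 : ℂ)} := by
  have hs := one_lt_sqrt_three
  have hspec (i : Fin 3) :
      ![-2, 1 - (Real.sqrt 3 : ℂ), -1 - (Real.sqrt 3 : ℂ)] i ∈ spectrum ℂ BMinusOneOne := by
    rw [← Matrix.spectrum_toLin']
    exact (Module.End.hasEigenvalue_of_hasEigenvector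
      ⟨negVec_mem_eigenspace i, negVec_ne_zero i⟩).mem_spectrum
  ext μ
  constructor
  · rintro ⟨hμ, x, rfl, hx⟩
    rw [← Matrix.spectrum_toLin', ← Module.End.hasEigenvalue_iff_mem_spectrum] at hμ
    obtain ⟨v, hv⟩ := hμ.exists_hasEigenvector
    exact (mem_of_mem_eigenspace_of_neg hx hv.1).2 hv.2
  · rintro (rfl | rfl | rfl)
    · exact ⟨hspec 2, -1 - √3, by simp, by linarith⟩
    · exact ⟨hspec 0, -2, by simp, by norm_num⟩
    · exact ⟨hspec 1, 1 - √3, by simp, by linarith⟩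

lemma negSpace_BMinusOneOne :
    negSpace BMinusOneOne = Submodule.span ℂ (Set.range negVec) := by
  apply le_antisymm
  · refine iSup₂_le ?_
    rintro _ ⟨-, x, rfl, hx⟩ v hv
    exact (mem_of_mem_eigenspace_of_neg hx hv).1
  · rw [Submodule.span_le]
    rintro _ ⟨i, rfl⟩
    refine Submodule.mem_iSup_of_mem _ (Submodule.mem_iSup_of_mem ?_ (negVec_mem_eigenspace i))
    rw [negEigenvalues_BMinusOneOne]
    fin_cases i <;> simp

lemma three_sub_sqrt_three_ne_zero : 3 - (Real.sqrt 3 : ℂ) ≠ 0 := by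
  intro h
  have h1 : (Real.sqrt 3 : ℂ) = 3 := by linear_combination -h
  have h2 := sqrt_three_sq
  rw [h1] at h2
  norm_num at h2

lemma eq_zero_of_hVec_add {a b : ℂ}
    (h : a • hVec (-2) + b • hVec (1 - (Real.sqrt 3 : ℂ)) = 0) : a = 0 ∧ b = 0 := by
  have h1 := congrFun h 1
  have h2 := congrFun h 2
  simp [hVec] at h1 h2
  have hb : b = 0 := by
    refine (mul_eq_zero.1 ?_).resolve_right three_sub_sqrt_three_ne_zero
    linear_combination h1 + h2
  exact ⟨by simpa [hb] using h2, hb⟩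

lemma sum_smul_negVec (g : Fin 3 → ℂ) :
    ∑ i, g i • negVec i =
      Sum.elim (g 0 • hVec (-2) + g 1 • hVec (1 - (Real.sqrt 3 : ℂ)) +
          g 2 • hVec (1 + (Real.sqrt 3 : ℂ)))
        (g 0 • hVec (-2) + g 1 • hVec (1 - (Real.sqrt 3 : ℂ)) -
          g 2 • hVec (1 + (Real.sqrt 3 : ℂ))) := by
  ext i
  rcases i with i | i <;> simp [Fin.sum_univ_three, negVec, parityVec, sub_eq_add_neg]

lemma mem_eigenspace_inversionOp_iff {v : Fin 3 ⊕ Fin 3 → ℂ} :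
    v ∈ Module.End.eigenspace (Matrix.toLin' inversionOp) (-1) ↔
      ∀ i, v (.inl i) + v (.inr i) = 0 := by
  rw [Module.End.mem_eigenspace_iff, Matrix.toLin'_apply, inversionOp,
    Matrix.fromBlocks_mulVec]
  simp only [funext_iff, Sum.forall]
  simp only [Matrix.zero_mulVec, Matrix.one_mulVec, Sum.elim_inl, Sum.elim_inr, Pi.add_apply,
    Pi.smul_apply, Pi.zero_apply, Function.comp_apply, smul_eq_mul]
  refine ⟨fun h i => by linear_combination h.1 i, fun h => ⟨fun i => ?_, fun i => ?_⟩⟩ <;>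
    linear_combination h i

lemma coeff_eq_zero_of_mem_eigenspace_inversionOp {g : Fin 3 → ℂ}
    (h : ∑ i, g i • negVec i ∈ Module.End.eigenspace (Matrix.toLin' inversionOp) (-1)) :
    g 0 = 0 ∧ g 1 = 0 := by
  rw [mem_eigenspace_inversionOp_iff] at h
  apply eq_zero_of_hVec_add
  ext i
  have := h i
  rw [sum_smul_negVec] at this
  simp only [Sum.elim_inl, Sum.elim_inr, Pi.add_apply, Pi.sub_apply] at this
  simp only [Pi.add_apply, Pi.zero_apply]
  linear_combination this / 2

lemma linearIndependent_negVec : LinearIndependent ℂ negVec := by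
  rw [Fintype.linearIndependent_iff]
  intro g hg
  obtain ⟨h0, h1⟩ := coeff_eq_zero_of_mem_eigenspace_inversionOp (g := g) (hg ▸ zero_mem _)
  have h2 : g 2 = 0 := by
    simpa [Fin.sum_univ_three, h0, h1, negVec_ne_zero] using hg
  intro i
  fin_cases i <;> assumption

lemma negSpace_inf_eigenspace_inversionOp :
    negSpace BMinusOneOne ⊓ Module.End.eigenspace (Matrix.toLin' inversionOp) (-1) =
      Submodule.span ℂ {negVec 2} := by
  rw [negSpace_BMinusOneOne]
  apply le_antisymm
  · rintro v ⟨hv, hI⟩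
    obtain ⟨g, rfl⟩ := (Submodule.mem_span_range_iff_exists_fun ℂ).1 hv
    obtain ⟨h0, h1⟩ := coeff_eq_zero_of_mem_eigenspace_inversionOp hI
    exact Submodule.mem_span_singleton.2 ⟨g 2, by simp [Fin.sum_univ_three, h0, h1]⟩
  · rw [Submodule.span_singleton_le_iff_mem]
    refine ⟨Submodule.subset_span ⟨2, rfl⟩, mem_eigenspace_inversionOp_iff.2 fun i => ?_⟩
    simp [negVec, parityVec]

lemma isHermitian_BMinusOneOne : BMinusOneOne.IsHermitian := by
  have h : hMinusOneOne.IsHermitian := by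
    ext i j
    fin_cases i <;> fin_cases j <;> simp [hMinusOneOne]
  exact Matrix.IsHermitian.fromBlocks Matrix.isHermitian_zero h Matrix.isHermitian_zero

/-- `n₋(−1,1) = 1`: `B = H₁(−1,1)` is Hermitian, its negative eigenvalues are exactly
`−1−√3, −2, 1−√3`, the sum of the corresponding eigenspaces is 3-dimensional, and its
intersection with the `(−1)`-eigenspace of the inversion operator is 1-dimensional. -/
theorem nMinus_at_minus_one_one :
    BMinusOneOne.IsHermitian ∧
    negEigenvalues BMinusOneOne =
      {(-1 - (Real.sqrt 3 : ℂ)), -2, 1 - (Real.sqrt 3 : ℂ)} ∧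
    Module.finrank ℂ ↥(negSpace BMinusOneOne) = 3 ∧
    Module.finrank ℂ
      ↥(negSpace BMinusOneOne ⊓ Module.End.eigenspace (Matrix.toLin' inversionOp) (-1)) = 1 := by
  refine ⟨isHermitian_BMinusOneOne, negEigenvalues_BMinusOneOne, ?_, ?_⟩
  · rw [negSpace_BMinusOneOne, finrank_span_eq_card linearIndependent_negVec, Fintype.card_fin]
  · rw [negSpace_inf_eigenspace_inversionOp, finrank_span_singleton (negVec_ne_zero 2)]
end

section
/- Let N ≥ 1, let H : 𝕋² → M_N(ℂ) be a continuous map taking Hermitian invertible values, and let Π, I ∈ M_N(ℂ) be Hermitian unitary matrices with Π I = −I Π and Π H(z,w) Π = −H(z,w) for all (z,w) ∈ 𝕋². Define H' on 𝕋² × ℝ by H'(z,w,θ) = H(z,w) cos θ − Π sin θ when cos θ ≥ 0, and H'(z,w,θ) = I cos θ − Π sin θ when cos θ ≤ 0. Then H'(z,w,θ) is an invertible matrix for every (z,w) ∈ 𝕋² and every θ ∈ ℝ; that is, the suspended Hamiltonian H' is gapped at zero energy on all of 𝕋³. -/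
open Complex Matrix

/-- The suspended Hamiltonian `H'(z,w,θ)` of the three-dimensional example (Section 5.2):
`H(z,w) cos θ − P sin θ` when `cos θ ≥ 0`, and `I cos θ − P sin θ` when `cos θ ≤ 0`. -/
noncomputable def suspend {N : ℕ} (H : ℂ → ℂ → Matrix (Fin N) (Fin N) ℂ)
    (P Iop : Matrix (Fin N) (Fin N) ℂ) (z w : ℂ) (θ : ℝ) : Matrix (Fin N) (Fin N) ℂ :=
  if 0 ≤ Real.cos θ then (Real.cos θ : ℂ) • H z w - (Real.sin θ : ℂ) • P
  else (Real.cos θ : ℂ) • Iop - (Real.sin θ : ℂ) • P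

open scoped ComplexOrder in
/-- If a Hermitian invertible matrix `X` anticommutes with an involution `P`, then
`c • X - s • P` is invertible for all real `c`, `s` that are not both zero. -/
theorem isUnit_smul_sub_smul_of_anticomm {n : Type*} [Fintype n] [DecidableEq n]
    {X P : Matrix n n ℂ} (hX : X.IsHermitian) (hXu : IsUnit X) (hP2 : P * P = 1)
    (hPX : P * X = -(X * P)) {c s : ℝ} (hcs : c ≠ 0 ∨ s ≠ 0) :
    IsUnit ((c : ℂ) • X - (s : ℂ) • P) := by
  by_cases hs : s = 0
  · have hc : (c : ℂ) ≠ 0 := by simpa [hs] using hcs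
    simpa [hs] using hXu.smul (Units.mk0 (c : ℂ) hc)
  have hsq : ((c : ℂ) • X - (s : ℂ) • P) ^ 2 =
      ((c : ℂ) • X)ᴴ * ((c : ℂ) • X) + ((s : ℂ) ^ 2) • (1 : Matrix n n ℂ) := by
    rw [conjTranspose_smul, hX.eq]
    simp only [pow_two, sub_mul, mul_sub, smul_mul_smul_comm, hP2, hPX, mul_comm (s : ℂ) c,
      RCLike.star_def, Complex.conj_ofReal, smul_neg]
    abel
  have hs2 : (0 : ℂ) < (s : ℂ) ^ 2 := by
    exact_mod_cast sq_pos_of_ne_zero hs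
  have hpos : (((c : ℂ) • X - (s : ℂ) • P) ^ 2).PosDef := by
    rw [hsq]
    exact PosDef.posSemidef_add (posSemidef_conjTranspose_mul_self _) (PosDef.one.smul hs2)
  exact (isUnit_pow_iff two_ne_zero).mp hpos.isUnit

/-- The suspended Hamiltonian `H'` is gapped at zero energy on all of `𝕋³`: for a gapped
Hermitian chiral-symmetric `H` on the two-torus, `H'(z,w,θ)` is invertible everywhere. -/
theorem suspend_isUnit
    {N : ℕ} (hN : 1 ≤ N) (H : ℂ → ℂ → Matrix (Fin N) (Fin N) ℂ)
    (hHcont : ContinuousOn (fun p : ℂ × ℂ => H p.1 p.2)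
      {p : ℂ × ℂ | ‖p.1‖ = 1 ∧ ‖p.2‖ = 1})
    (hHherm : ∀ z w : ℂ, ‖z‖ = 1 → ‖w‖ = 1 → (H z w).IsHermitian)
    (hHunit : ∀ z w : ℂ, ‖z‖ = 1 → ‖w‖ = 1 → IsUnit (H z w))
    (P Iop : Matrix (Fin N) (Fin N) ℂ)
    (hP : P.IsHermitian) (hP2 : P * P = 1)
    (hI : Iop.IsHermitian) (hI2 : Iop * Iop = 1)
    (hPI : P * Iop = -(Iop * P))
    (hchiral : ∀ z w : ℂ, ‖z‖ = 1 → ‖w‖ = 1 → P * H z w * P = -(H z w)) :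
    ∀ z w : ℂ, ∀ θ : ℝ, ‖z‖ = 1 → ‖w‖ = 1 → IsUnit (suspend H P Iop z w θ) := by
  intro z w θ hz hw
  have hcs : Real.cos θ ≠ 0 ∨ Real.sin θ ≠ 0 := by
    by_contra! h
    simpa [h.1, h.2] using Real.sin_sq_add_cos_sq θ
  have hPH : P * H z w = -(H z w * P) := by
    rw [← neg_mul, ← hchiral z w hz hw, mul_assoc, hP2, mul_one]
  unfold suspend
  split_ifs
  · exact isUnit_smul_sub_smul_of_anticomm (hHherm z w hz hw) (hHunit z w hz hw) hP2 hPH hcs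
  · exact isUnit_smul_sub_smul_of_anticomm hI (IsUnit.of_mul_eq_one Iop hI2) hP2 hPI hcs
end
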